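/- arXiv:2402.07096 — 2 statements merged into one kernel-verified Lean document; each statement's English description precedes it below -/
import Mathlib

section
/- Let R be a supercommutative superring that is a unique factorization superring (UFSR). Let a be a normal irreducible element of R with graded components a₀ ∈ 𝒜 0 and a₁ ∈ 𝒜 1 (so a = a₀ + a₁), and assume a₀ ≠ 0 and a₁ ≠ 0. Then a₀ is irreducible. (Claim established in the proof of Theorem 3.3 ii: the even part of an inhomogeneous normal irreducible element of a UFSR is irreducible.) -/
/-! Basic notions for supercommutative superrings, following the paper
"A note on unique factorization in superrings". -/

section Defs

variable {R : Type*} [Ring R]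

/-- `a` divides `b`: `b = c * a * d` for some `c, d`. -/
def SDvd (a b : R) : Prop := ∃ c d : R, b = c * a * d

/-- `a` is associated to `b`: `a = u * b * v` for units `u, v`. -/
def SAssociated (a b : R) : Prop := ∃ u v : Rˣ, a = (u : R) * b * (v : R)

/-- `a` is normal: `aR = Ra` as sets. -/
def SNormal (a : R) : Prop :=
  {x : R | ∃ r : R, x = a * r} = {x : R | ∃ r : R, x = r * a}

/-- `a` is irreducible: a non-unit which is not a product of two non-units. -/
def SIrreducible (a : R) : Prop :=
  ¬ IsUnit a ∧ ∀ b c : R, a = b * c → IsUnit b ∨ IsUnit c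

/-- `R` is a unique factorization superring: every nonzero non-unit admits a
factorization into normal irreducible elements, uniquely up to order and associates. -/
def IsUFSR (R : Type*) [Ring R] : Prop :=
  (∀ x : R, x ≠ 0 → ¬ IsUnit x →
      ∃ (d : ℕ) (f : Fin d → R),
        (∀ i, SNormal (f i) ∧ SIrreducible (f i)) ∧ x = (List.ofFn f).prod) ∧
  (∀ x : R, x ≠ 0 → ¬ IsUnit x →
      ∀ (d n : ℕ) (f : Fin d → R) (g : Fin n → R),
        (∀ i, SNormal (f i) ∧ SIrreducible (f i)) →
        (∀ i, SNormal (g i) ∧ SIrreducible (g i)) →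
        x = (List.ofFn f).prod → x = (List.ofFn g).prod →
        ∃ h : d = n, ∃ σ : Equiv.Perm (Fin n),
          ∀ i : Fin n, SAssociated (f (Fin.cast h.symm i)) (g (σ i)))

end Defs

/-- The supercommutativity condition for a `ℤ₂`-grading `𝒜` on `R`. -/
def SuperComm {R : Type*} [Ring R] (𝒜 : ZMod 2 → AddSubgroup R) : Prop :=
  ∀ (i j : ZMod 2), ∀ x ∈ 𝒜 i, ∀ y ∈ 𝒜 j,
    x * y = ((-1 : ℤ) ^ (i.val * j.val)) • (y * x)

/-- `2` is a non-zerodivisor in `R`. -/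
def TwoRegular (R : Type*) [Ring R] : Prop := ∀ x : R, 2 * x = 0 → x = 0

/-- The canonical superideal `𝒥 = R·R₁`, the (two-sided, by supercommutativity)
ideal generated by the odd part. -/
def canonicalSuperideal {R : Type*} [Ring R] (𝒜 : ZMod 2 → AddSubgroup R) : Ideal R :=
  Ideal.span (𝒜 1 : Set R)

/-- `R` is a superdomain: `𝒥` is a proper completely prime ideal. -/
def IsSuperdomain {R : Type*} [Ring R] (𝒜 : ZMod 2 → AddSubgroup R) : Prop :=
  (1 : R) ∉ canonicalSuperideal 𝒜 ∧
    ∀ a b : R, a * b ∈ canonicalSuperideal 𝒜 →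
      a ∈ canonicalSuperideal 𝒜 ∨ b ∈ canonicalSuperideal 𝒜

section Helpers

variable {R : Type*} [Ring R]

lemma UF_exists (h : IsUFSR R) (x : R) (hx : x ≠ 0) (hu : ¬ IsUnit x) :
    ∃ l : List R, (∀ y ∈ l, SNormal y ∧ SIrreducible y) ∧ x = l.prod ∧ l ≠ [] := by
  obtain ⟨d, f, hf, hp⟩ := h.1 x hx hu
  refine ⟨List.ofFn f, ?_, hp, ?_⟩
  · intro y hy
    rw [List.mem_ofFn] at hy
    obtain ⟨i, rfl⟩ := hy
    exact hf i
  · intro h0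
    rw [h0] at hp
    exact hu (by simp [hp])

lemma UF_length (h : IsUFSR R) (l m : List R)
    (hl : ∀ y ∈ l, SNormal y ∧ SIrreducible y) (hm : ∀ y ∈ m, SNormal y ∧ SIrreducible y)
    (hx : l.prod ≠ 0) (hu : ¬ IsUnit l.prod) (e : l.prod = m.prod) : l.length = m.length := by
  obtain ⟨h, -⟩ := h.2 l.prod hx hu l.length m.length l.get m.get
    (fun i => hl _ (List.get_mem _ _)) (fun i => hm _ (List.get_mem _ _))
    (by rw [List.ofFn_get]) (by rw [List.ofFn_get]; exact e)
  exact h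

lemma SAssociated.trans' {a b c : R} (h : SAssociated a b) (k : SAssociated b c) :
    SAssociated a c := by
  obtain ⟨u, v, rfl⟩ := h
  obtain ⟨s, t, rfl⟩ := k
  exact ⟨u * s, t * v, by simp [mul_assoc]⟩

lemma UF_two (h : IsUFSR R) (b p q : R) (hb : SNormal b ∧ SIrreducible b)
    (hp : SNormal p ∧ SIrreducible p) (hq : SNormal q ∧ SIrreducible q)
    (hx : b * p ≠ 0) (hu : ¬ IsUnit (b * p)) (e : b * p = b * q) : SAssociated p q := by
  obtain ⟨hd, σ, hσ⟩ := h.2 (b * p) hx hu 2 2 ![b, p] ![b, q]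
    (by intro i; fin_cases i <;> simpa) (by intro i; fin_cases i <;> simpa)
    (by simp) (by simpa using e)
  have h1 := hσ 1
  have h0 := hσ 0
  have hne : σ 0 ≠ σ 1 := fun hh => by simpa using σ.injective hh
  generalize σ 0 = i at *
  generalize σ 1 = j at *
  fin_cases i <;> fin_cases j <;> simp at h0 h1 hne
  · exact h1
  · exact h1.trans' h0

lemma SNormal.right {a : R} (h : SNormal a) (r : R) : ∃ s, a * r = s * a := by
  have : a * r ∈ {x : R | ∃ r : R, x = a * r} := ⟨r, rfl⟩
  rw [h] at this
  exact this

lemma SNormal.left {a : R} (h : SNormal a) (r : R) : ∃ s, r * a = a * s := by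
  have : r * a ∈ {x : R | ∃ r : R, x = r * a} := ⟨r, rfl⟩
  rw [← h] at this
  exact this

lemma key (h : IsUFSR R) (a b p : R) (ha : SNormal a ∧ SIrreducible a)
    (hb : SNormal b ∧ SIrreducible b) (hp : SNormal p ∧ SIrreducible p)
    (hba : b * a = 0) : b * p = 0 := by
  by_contra hne
  have e : b * p = b * (p + a) := by rw [mul_add, hba, add_zero]
  have hqu : ¬ IsUnit (p + a) := by
    rintro ⟨u, hu⟩
    rw [← hu] at e
    have e2 : b = b * (p * (↑u⁻¹ : R)) := by
      rw [← mul_assoc, e, mul_assoc, Units.mul_inv, mul_one]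
    rcases hb.2.2 _ _ e2 with h1 | h1
    · exact hb.2.1 h1
    · exact hp.2.1 (by simpa using h1)
  have hbu : ¬ IsUnit (b * p) := by
    rintro ⟨u, hu⟩
    have e1 : b * (p * (↑u⁻¹ : R)) = 1 := by rw [← mul_assoc, ← hu, Units.mul_inv]
    obtain ⟨s, hs⟩ := hb.1.right (p * (↑u⁻¹ : R))
    rw [e1] at hs
    have e3 : s = p * (↑u⁻¹ : R) := left_inv_eq_right_inv hs.symm e1
    exact hb.2.1 ⟨⟨b, s, by rw [e3, e1], hs.symm⟩, rfl⟩
  have hq0 : p + a ≠ 0 := fun h0 => hne (by rw [e, h0, mul_zero])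
  obtain ⟨l, hl, hlp, -⟩ := UF_exists h _ hq0 hqu
  have hlen := UF_length h [b, p] (b :: l) (by simp [hb, hp])
    (by simpa [hb] using hl) (by simpa using hne) (by simpa using hbu)
    (by simpa [← hlp] using e)
  have hq : SNormal (p + a) ∧ SIrreducible (p + a) := by
    match l, hlen with
    | [x], _ =>
      have : p + a = x := by simpa using hlp
      rw [this]; exact hl x (by simp)
  obtain ⟨u, v, huv⟩ := UF_two h b p (p + a) hb hp hq hne hbu e
  have e4 : p + a = (↑u⁻¹ : R) * (p * (↑v⁻¹ : R)) := by
    rw [← mul_assoc]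
    conv_rhs => rw [huv]
    simp [mul_assoc]
  obtain ⟨s, hs⟩ := hp.1.right (↑v⁻¹ : R)
  rw [hs] at e4
  have e5 : a = ((↑u⁻¹ : R) * s - 1) * p := by
    rw [sub_mul, one_mul, mul_assoc, ← e4]; abel
  rcases ha.2.2 _ _ e5 with ⟨w, hw⟩ | h1
  · rw [← hw] at e5
    have e6 : p = (↑w⁻¹ : R) * a := by rw [e5]; simp
    obtain ⟨t, ht⟩ := hb.1.right (↑w⁻¹ : R)
    apply hne
    rw [e6, ← mul_assoc, ht, mul_assoc, hba, mul_zero]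
  · exact hp.2.1 h1

lemma key2 (h : IsUFSR R) (a f : R) (ha : SNormal a ∧ SIrreducible a)
    (hf : SNormal f ∧ SIrreducible f) (haa : a * a = 0) : f * a = 0 := by
  by_contra hne
  obtain ⟨r, hr⟩ := ha.1.left f
  have hr0 : r ≠ 0 := by rintro rfl; exact hne (by rw [hr, mul_zero])
  have hru : ¬ IsUnit r := by
    rintro ⟨u, rfl⟩
    have e2 : a = f * (a * (↑u⁻¹ : R)) := by
      rw [← mul_assoc, hr, mul_assoc, Units.mul_inv, mul_one]
    rcases ha.2.2 _ _ e2 with h1 | h1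
    · exact hf.2.1 h1
    · exact ha.2.1 (by simpa using h1)
  obtain ⟨l, hl, hlp, hl0⟩ := UF_exists h r hr0 hru
  match l, hl0 with
  | x :: t, _ =>
    have := key h a a x ha ha (hl x (by simp)) haa
    apply hne
    rw [hr, hlp, List.prod_cons, ← mul_assoc, this, zero_mul]

end Helpers

/-- Claim in the proof of **Theorem 3.3 ii)**: if `a = a₀ + a₁` is an inhomogeneous
normal irreducible element of a UFSR (with `a₀` even, `a₁` odd, both nonzero),
then the even part `a₀` is irreducible. -/
theorem ufsr_even_part_of_normal_irreducible_is_irreducible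
    {R : Type*} [Ring R] [Nontrivial R]
    (𝒜 : ZMod 2 → AddSubgroup R) [GradedRing 𝒜]
    (hsc : SuperComm 𝒜) (h2 : TwoRegular R) (hodd : 𝒜 1 ≠ ⊥)
    (hufsr : IsUFSR R)
    (a a₀ a₁ : R) (ha₀ : a₀ ∈ 𝒜 0) (ha₁ : a₁ ∈ 𝒜 1)
    (hsum : a = a₀ + a₁) (h0 : a₀ ≠ 0) (h1 : a₁ ≠ 0)
    (hnorm : SNormal a) (hirr : SIrreducible a) :
    SIrreducible a₀ := by
  have hc : a₀ * a₁ = a₁ * a₀ := by simpa using hsc 0 1 a₀ ha₀ a₁ ha₁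
  have hsq : a₁ * a₁ = 0 := by
    have h := hsc 1 1 a₁ ha₁ a₁ ha₁
    have hv : (1 : ZMod 2).val = 1 := rfl
    simp only [hv, mul_one, pow_one, neg_smul, one_smul] at h
    apply h2
    rw [two_mul]
    nth_rewrite 1 [h]
    simp
  have hu0 : ¬ IsUnit a₀ := by
    rintro ⟨u, hu⟩
    apply hirr.1
    have e1 : a * (a₀ - a₁) = a₀ * a₀ := by
      rw [hsum, add_mul, mul_sub, mul_sub, hsq, hc]; abel
    have e2 : (a₀ - a₁) * a = a₀ * a₀ := by
      rw [hsum, sub_mul, mul_add, mul_add, hsq, hc]; abel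
    rw [← hu] at e1 e2
    have e3 : a * ((↑u - a₁) * ((↑u⁻¹ : R) * (↑u⁻¹ : R))) = 1 := by
      rw [← mul_assoc, e1]; simp [mul_assoc]
    have e4 : (((↑u⁻¹ : R) * (↑u⁻¹ : R)) * (↑u - a₁)) * a = 1 := by
      rw [mul_assoc, e2]; simp [mul_assoc]
    exact ⟨⟨a, _, e3, by rw [← left_inv_eq_right_inv e4 e3]; exact e4⟩, rfl⟩
  have hu1 : ¬ IsUnit a₁ := fun hh => h1 ((hh.mul_right_eq_zero).1 hsq)
  have ha : SNormal a ∧ SIrreducible a := ⟨hnorm, hirr⟩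
  obtain ⟨l, hl, hlp, hl0⟩ := UF_exists hufsr a₀ h0 hu0
  have done : l.length = 1 → SIrreducible a₀ := by
    intro hlen
    obtain ⟨x, rfl⟩ := List.length_eq_one_iff.1 hlen
    have : a₀ = x := by simpa using hlp
    rw [this]; exact (hl x (by simp)).2
  by_cases h01 : a₀ * a₁ = 0
  · have haa : a * a = a₀ * a₀ := by
      rw [hsum, add_mul, mul_add, mul_add, hsq, ← hc, h01]; simp
    by_cases h00 : a₀ * a₀ = 0
    · rw [h00] at haa
      match l, hl0 with
      | [x], _ => exact done rfl
      | x :: y :: t, _ =>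
        exfalso
        have hx := hl x (by simp)
        have hy := hl y (by simp)
        have := key hufsr a x y ha hx hy (key2 hufsr a x ha hx haa)
        apply h0
        rw [hlp, List.prod_cons, List.prod_cons, ← mul_assoc, this, zero_mul]
    · have := UF_length hufsr [a, a] (l ++ l) (by simp [ha])
        (by simpa using hl) (by simpa [haa] using h00)
        (by
          intro hh
          have hh : IsUnit (a₀ * a₀) := by simpa [haa] using hh
          exact hu0 ((Commute.refl a₀).isUnit_mul_iff.1 hh).1)
        (by simp [haa, ← hlp])
      apply done
      simp at this
      omega
  · obtain ⟨m, hm, hmp, -⟩ := UF_exists hufsr a₁ h1 hu1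
    have haa : a * a₁ = a₀ * a₁ := by rw [hsum, add_mul, hsq, add_zero]
    have hnu : ¬ IsUnit (a₀ * a₁) := fun hh =>
      hu0 ((show Commute a₀ a₁ from hc).isUnit_mul_iff.1 hh).1
    have := UF_length hufsr (a :: m) (l ++ m) (by simpa [ha] using hm)
      (by
        intro y hy
        rcases List.mem_append.1 hy with hy | hy
        exacts [hl y hy, hm y hy])
      (by simpa [← hmp, haa] using h01) (by simpa [← hmp, haa] using hnu)
      (by simp [haa, ← hlp, ← hmp])
    apply done
    simp at this
    omega
end

section
/- Let R be a supercommutative superring that is a Noetherian superring and is local, in the sense that the set M of non-units of R forms a (two-sided) ideal (∀ x, x ∈ M ↔ ¬IsUnit x). For n ≥ 1 let M^n denote the additive subgroup of R generated by all ordered products of n elements of M. Then exactly one of the following holds: (i) M^n ≠ M^(n+1) for every n ≥ 1; (ii) there exists n with M^n = ⊥ (every product of n elements of M is zero), and in this case R is an Artinian superring, i.e. every decreasing chain of homogeneous ideals of R is eventually constant. (Proposition 3.8 of the paper.) -/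
/-- `R` is oddly-Noetherian: the odd part `𝒜 1` is finitely generated
over the even part `𝒜 0`. -/
def IsOddlyNoetherian {R : Type*} [Ring R] (𝒜 : ZMod 2 → AddSubgroup R) : Prop :=
  ∃ (n : ℕ) (z : Fin n → R), (∀ j, z j ∈ 𝒜 1) ∧
    ∀ x ∈ 𝒜 1, ∃ a : Fin n → R, (∀ j, a j ∈ 𝒜 0) ∧ x = ∑ j, a j * z j

/-- The even subring `R₀` of `R`, with carrier `𝒜 0`. -/
def evenSubring {R : Type*} [Ring R] (𝒜 : ZMod 2 → AddSubgroup R) [GradedRing 𝒜] :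
    Subring R where
  carrier := 𝒜 0
  mul_mem' := fun {a b} ha hb => by simpa using SetLike.mul_mem_graded ha hb
  one_mem' := SetLike.one_mem_graded 𝒜
  add_mem' := fun {a b} ha hb => (𝒜 0).add_mem ha hb
  zero_mem' := (𝒜 0).zero_mem
  neg_mem' := fun {a} ha => (𝒜 0).neg_mem ha

/-- The additive subgroup of `R` generated by all ordered products of `n`
elements of the set `S`. -/
def prodPow {R : Type*} [Ring R] (S : Set R) (n : ℕ) : AddSubgroup R :=
  AddSubgroup.closure
    {x : R | ∃ f : Fin n → R, (∀ i, f i ∈ S) ∧ x = (List.ofFn f).prod}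

/-- `R` is an Artinian superring: every decreasing sequence of homogeneous
two-sided ideals of `R` is eventually constant. -/
def IsArtinianSuperring {R : Type*} [Ring R]
    (𝒜 : ZMod 2 → AddSubgroup R) [GradedRing 𝒜] : Prop :=
  ∀ I : ℕ → Ideal R,
    (∀ n, ∀ x ∈ I n, ∀ r : R, x * r ∈ I n) →
    (∀ n, ∀ x ∈ I n, ∀ i : ZMod 2, (DirectSum.decompose 𝒜 x i : R) ∈ I n) →
    (∀ n, I (n + 1) ≤ I n) →
    ∃ N : ℕ, ∀ m : ℕ, N ≤ m → I m = I N


theorem prodPow_eq_pow {R : Type*} [Ring R] (M : Ideal R) (n : ℕ) :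
    prodPow (M : Set R) (n + 1) = (M ^ (n + 1)).toAddSubgroup := by
  induction n with
  | zero =>
    apply le_antisymm
    · refine (AddSubgroup.closure_le _).2 ?_
      rintro x ⟨f, hf, rfl⟩
      change _ ∈ M ^ 1
      rw [Submodule.pow_one]
      simpa using hf 0
    · intro x hx
      refine AddSubgroup.subset_closure ⟨fun _ => x, fun _ => ?_, by simp⟩
      change x ∈ M ^ (0 + 1) at hx
      rw [zero_add, Submodule.pow_one] at hx
      exact hx
  | succ n ih =>
    apply le_antisymm
    · refine (AddSubgroup.closure_le _).2 ?_
      rintro x ⟨f, hf, rfl⟩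
      rw [List.ofFn_succ, List.prod_cons]
      change _ ∈ M ^ (n + 1 + 1)
      rw [Submodule.pow_succ' M (Nat.succ_ne_zero n)]
      refine Ideal.mul_mem_mul (hf 0) ?_
      change _ ∈ (M ^ (n + 1)).toAddSubgroup
      rw [← ih]
      exact AddSubgroup.subset_closure ⟨fun i => f i.succ, fun i => hf _, rfl⟩
    · intro x hx
      change x ∈ M ^ (n + 1 + 1) at hx
      rw [Submodule.pow_succ' M (Nat.succ_ne_zero n)] at hx
      refine Submodule.smul_induction_on hx ?_ (fun x y hx hy => add_mem hx hy)
      intro a ha b hb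
      change b ∈ (M ^ (n + 1)).toAddSubgroup at hb
      rw [← ih] at hb
      refine AddSubgroup.closure_induction
        (p := fun b _ => a • b ∈ prodPow (M : Set R) (n + 1 + 1)) ?_ ?_ ?_ ?_ hb
      · rintro _ ⟨f, hf, rfl⟩
        refine AddSubgroup.subset_closure ⟨Fin.cons a f, ?_, ?_⟩
        · intro i
          refine Fin.cases ?_ (fun j => ?_) i
          · simpa using ha
          · simpa using hf j
        · rw [List.ofFn_succ, List.prod_cons]
          simp
      · rw [smul_zero]; exact zero_mem _
      · intro x y _ _ hx hy
        rw [smul_add]; exact add_mem hx hy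
      · intro x _ hx
        rw [smul_neg]; exact neg_mem hx

theorem superring_isNoetherianRing {R : Type*} [Ring R]
    (𝒜 : ZMod 2 → AddSubgroup R) [GradedRing 𝒜]
    (hON : IsOddlyNoetherian 𝒜) (hNoeth : IsNoetherianRing (evenSubring 𝒜)) :
    IsNoetherianRing R := by
  obtain ⟨n, z, hz, h⟩ := hON
  have hfin : Module.Finite (evenSubring 𝒜) R := by
    refine ⟨Submodule.fg_def.2 ⟨insert 1 (Set.range z), (Set.finite_range z).insert 1, ?_⟩⟩
    rw [eq_top_iff]
    intro x _
    have hx : x = (DirectSum.decompose 𝒜 x 0 : R) + (DirectSum.decompose 𝒜 x 1 : R) := by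
      classical
      have hs := DirectSum.sum_support_decompose 𝒜 x
      rw [Finset.sum_subset (Finset.subset_univ _) (fun i _ hi => by
        simpa using hi)] at hs
      exact hs.symm.trans (Fin.sum_univ_two
        (fun i : Fin 2 => ((DirectSum.decompose 𝒜 x (i : ZMod 2) : 𝒜 _) : R)))
    rw [hx]
    refine add_mem ?_ ?_
    · have := Submodule.smul_mem (Submodule.span (evenSubring 𝒜) (insert 1 (Set.range z)))
        (⟨_, (DirectSum.decompose 𝒜 x 0).2⟩ : evenSubring 𝒜)
        (Submodule.subset_span (Set.mem_insert 1 _))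
      simpa [Subring.smul_def] using this
    · obtain ⟨a, ha, e⟩ := h _ (DirectSum.decompose 𝒜 x 1).2
      rw [e]
      refine sum_mem fun j _ => ?_
      exact Submodule.smul_mem _ (⟨a j, ha j⟩ : evenSubring 𝒜)
        (Submodule.subset_span (Set.mem_insert_of_mem _ ⟨j, rfl⟩))
  have : IsNoetherian (evenSubring 𝒜) R := isNoetherian_of_isNoetherianRing_of_finite _ _
  exact isNoetherian_of_tower (evenSubring 𝒜) this

theorem local_jacobson_eq {R : Type*} [Ring R] [Nontrivial R] (M : Ideal R)
    (hM : ∀ x : R, x ∈ M ↔ ¬ IsUnit x) : Ring.jacobson R = M := by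
  have hle : ∀ I : Ideal R, I ≠ ⊤ → I ≤ M := fun I hI x hx =>
    (hM x).2 fun hu => hI (Ideal.eq_top_of_isUnit_mem I hx hu)
  have hMt : M ≠ ⊤ := fun h => (hM 1).1 (h ▸ Submodule.mem_top) isUnit_one
  have hmax : M.IsMaximal := ⟨⟨hMt, fun J hJ => by
    by_contra hne
    exact absurd (hle J hne) (not_le_of_gt hJ)⟩⟩
  rw [← Ideal.jacobson_bot]
  apply le_antisymm
  · exact sInf_le ⟨bot_le, hmax⟩
  · refine le_sInf ?_
    rintro J ⟨-, hJ⟩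
    exact (hJ.eq_of_le hMt (hle J hJ.ne_top)).ge

theorem local_quot_semisimple {R : Type*} [Ring R] [Nontrivial R] (M : Ideal R)
    (hM : ∀ x : R, x ∈ M ↔ ¬ IsUnit x) : IsSemisimpleRing (R ⧸ Ring.jacobson R) := by
  have hJ := local_jacobson_eq M hM
  have hnt : Nontrivial (R ⧸ Ring.jacobson R) := by
    refine Ideal.Quotient.nontrivial_iff.2 ?_
    rw [hJ]
    exact fun h => (hM 1).1 (h ▸ Submodule.mem_top) isUnit_one
  let _ : DivisionRing (R ⧸ Ring.jacobson R) := DivisionRing.ofIsUnitOrEqZero (by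
    intro a
    obtain ⟨x, rfl⟩ := Ideal.Quotient.mk_surjective a
    by_cases hx : IsUnit x
    · exact Or.inl (hx.map _)
    · right
      rw [Ideal.Quotient.eq_zero_iff_mem, hJ]
      exact (hM x).2 hx)
  infer_instance

/-- **Proposition 3.8**: for a local Noetherian superring `(R, 𝔪)`, exactly one of
the following holds: (i) `𝔪^n ≠ 𝔪^(n+1)` for all `n ≥ 1`; (ii) `𝔪^n = 0` for some
`n ≥ 1`, in which case `R` is an Artinian superring. -/
theorem local_noetherian_superring_maximal_pow_dichotomy
    {R : Type*} [Ring R] [Nontrivial R]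
    (𝒜 : ZMod 2 → AddSubgroup R) [GradedRing 𝒜]
    (hsc : SuperComm 𝒜) (h2 : TwoRegular R)
    (hON : IsOddlyNoetherian 𝒜) (hNoeth : IsNoetherianRing (evenSubring 𝒜))
    (M : Ideal R) (hMr : ∀ x ∈ M, ∀ r : R, x * r ∈ M)
    (hM : ∀ x : R, x ∈ M ↔ ¬ IsUnit x) :
    Xor'
      (∀ n : ℕ, 1 ≤ n → prodPow (M : Set R) n ≠ prodPow (M : Set R) (n + 1))
      ((∃ n : ℕ, 1 ≤ n ∧ prodPow (M : Set R) n = ⊥) ∧ IsArtinianSuperring 𝒜) := by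
  have hR : IsNoetherianRing R := superring_isNoetherianRing 𝒜 hON hNoeth
  have hJ := local_jacobson_eq M hM
  have hart : (∃ n : ℕ, 1 ≤ n ∧ prodPow (M : Set R) n = ⊥) → IsArtinianSuperring 𝒜 := by
    rintro ⟨n, hn, h⟩
    obtain ⟨n, rfl⟩ : ∃ k, n = k + 1 := ⟨n - 1, by omega⟩
    rw [prodPow_eq_pow] at h
    have hnil : IsNilpotent (Ring.jacobson R) := by
      refine ⟨n + 1, ?_⟩
      rw [hJ]
      refine (Submodule.eq_bot_iff _).2 fun x hx => ?_
      have : x ∈ (M ^ (n + 1)).toAddSubgroup := hx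
      rw [h] at this
      exact this
    have : IsSemiprimaryRing R := ⟨local_quot_semisimple M hM, hnil⟩
    have hA : IsArtinian R R := IsSemiprimaryRing.isNoetherian_iff_isArtinian.1 hR
    intro I _ _ hI
    obtain ⟨N, hN⟩ := IsArtinian.monotone_stabilizes
      (⟨fun n => OrderDual.toDual (I n), monotone_nat_of_le_succ hI⟩ : ℕ →o (Ideal R)ᵒᵈ)
    exact ⟨N, fun m hm => (hN m hm).symm⟩
  by_cases h1 : ∀ n : ℕ, 1 ≤ n → prodPow (M : Set R) n ≠ prodPow (M : Set R) (n + 1)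
  · refine Or.inl ⟨h1, ?_⟩
    rintro ⟨⟨n, hn, h⟩, -⟩
    refine h1 n hn ?_
    obtain ⟨n, rfl⟩ : ∃ k, n = k + 1 := ⟨n - 1, by omega⟩
    rw [h, eq_comm, eq_bot_iff, ← h, prodPow_eq_pow, prodPow_eq_pow]
    intro x hx
    change x ∈ M ^ (n + 1 + 1) at hx
    rw [Submodule.pow_succ' M (Nat.succ_ne_zero n)] at hx
    exact Ideal.mul_le_right hx
  · refine Or.inr ⟨?_, h1⟩
    push Not at h1
    obtain ⟨n, hn, h⟩ := h1
    have hex : ∃ n : ℕ, 1 ≤ n ∧ prodPow (M : Set R) n = ⊥ := by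
      refine ⟨n, hn, ?_⟩
      obtain ⟨n, rfl⟩ : ∃ k, n = k + 1 := ⟨n - 1, by omega⟩
      rw [prodPow_eq_pow, prodPow_eq_pow] at h
      have hb : M ^ (n + 1) = ⊥ := by
        refine Submodule.FG.eq_bot_of_le_jacobson_smul (IsNoetherian.noetherian _) ?_
        intro x hx
        have hx' : x ∈ (M ^ (n + 1)).toAddSubgroup := hx
        rw [h] at hx'
        change x ∈ M ^ (n + 1 + 1) at hx'
        rw [Submodule.pow_succ' M (Nat.succ_ne_zero n)] at hx'
        rw [hJ]
        exact hx'
      rw [prodPow_eq_pow, hb]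
      rfl
    exact ⟨hex, hart hex⟩
end
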